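/- (Jarník) Let Θ be an n×2 real matrix with ψ_Θ(t) > 0 for all t > 0, and assume α(Θ) is finite. Then β(Θ) ≥ α(Θ)·(α(Θ) − 1). -/

import Mathlib

open Filter
open scoped ENNReal

/-- Distance from a real number to the nearest integer. -/
noncomputable def nid (x : ℝ) : ℝ := |x - round x|

/-- Sup-norm height `M(x) = max_i |x_i|` of an integer vector. -/
def heightM {m : ℕ} (x : Fin m → ℤ) : ℕ := Finset.univ.sup fun i => (x i).natAbs

/-- `ψ_Θ(t) = min { max_j ‖L_j(x)‖ : x ∈ ℤ^m, 0 < M(x) ≤ t }`, valued in `ℝ≥0∞`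
(the infimum over the empty family is `⊤`). -/
noncomputable def psiFn {n m : ℕ} (Θ : Matrix (Fin n) (Fin m) ℝ) (t : ℝ) : ℝ≥0∞ :=
  ⨅ (x : Fin m → ℤ) (_ : x ≠ 0) (_ : (heightM x : ℝ) ≤ t),
    ENNReal.ofReal (⨆ j : Fin n, nid (∑ i, Θ j i * (x i : ℝ)))

/-- The set `{γ > 0 : limsup_{t→∞} t^γ ψ_Θ(t) < ∞}`. -/
noncomputable def uniformExps {n m : ℕ} (Θ : Matrix (Fin n) (Fin m) ℝ) : Set ℝ :=
  {γ : ℝ | 0 < γ ∧ limsup (fun t : ℝ => ENNReal.ofReal (t ^ γ) * psiFn Θ t) atTop < ⊤}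

/-- The set `{γ > 0 : liminf_{t→∞} t^γ ψ_Θ(t) < ∞}`. -/
noncomputable def individualExps {n m : ℕ} (Θ : Matrix (Fin n) (Fin m) ℝ) : Set ℝ :=
  {γ : ℝ | 0 < γ ∧ liminf (fun t : ℝ => ENNReal.ofReal (t ^ γ) * psiFn Θ t) atTop < ⊤}

/-- The uniform Diophantine exponent `α(Θ)`, valued in `ℝ≥0∞`. -/
noncomputable def alphaExp {n m : ℕ} (Θ : Matrix (Fin n) (Fin m) ℝ) : ℝ≥0∞ :=
  sSup (ENNReal.ofReal '' uniformExps Θ)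

/-- The individual Diophantine exponent `β(Θ)`, valued in `ℝ≥0∞`. -/
noncomputable def betaExp {n m : ℕ} (Θ : Matrix (Fin n) (Fin m) ℝ) : ℝ≥0∞ :=
  sSup (ENNReal.ofReal '' individualExps Θ)

/-- Abstract core of Jarnik's argument for a sequence of minimal points. -/
lemma jarnik_core {n : ℕ} (θ φ : Fin n → ℝ) (a b : ℕ → ℤ) (y : ℕ → Fin n → ℤ)
    (X Z : ℕ → ℝ) (γ C : ℝ) (K : ℕ) (hγ : 1 < γ)
    (ha : ∀ k, |(a k : ℝ)| ≤ X k) (hb : ∀ k, |(b k : ℝ)| ≤ X k)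
    (hab : ∀ k, |(a k : ℝ)| = X k ∨ |(b k : ℝ)| = X k)
    (hX1 : ∀ k, 1 ≤ X k) (hXm : ∀ k, X k ≤ X (k+1)) (hXt : Tendsto X atTop atTop)
    (hZ0 : ∀ k, 0 < Z k) (hZd : ∀ k, Z (k+1) < Z k)
    (hE : ∀ k j, |θ j * a k + φ j * b k - y k j| ≤ Z k)
    (hEa : ∀ k, ∃ j, |θ j * a k + φ j * b k - y k j| = Z k)
    (hC : ∀ k, K ≤ k → X (k+1) ^ γ * Z k ≤ C) :
    ∃ C' : ℝ, ∃ᶠ k in atTop, X k ^ (γ * (γ - 1)) * Z k ≤ C' := by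
  have hX0 : ∀ k, 0 < X k := fun k => lt_of_lt_of_le one_pos (hX1 k)
  have hC0 : 0 < C := lt_of_lt_of_le
    (mul_pos (Real.rpow_pos_of_pos (hX0 (K+1)) γ) (hZ0 K)) (hC K le_rfl)
  -- `X (k+1) * Z k` tends to zero
  have hsmall : ∀ ε : ℝ, 0 < ε → ∀ᶠ k in atTop, X (k+1) * Z k < ε := by
    intro ε hε
    have h1 : Tendsto (fun k => X (k+1) ^ (γ - 1)) atTop atTop :=
      (tendsto_rpow_atTop (by linarith)).comp (hXt.comp (tendsto_add_atTop_nat 1))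
    filter_upwards [h1.eventually_gt_atTop (C / ε), eventually_ge_atTop K] with k hk hkK
    have h2 := hC k hkK
    have h3 : X (k+1) ^ γ = X (k+1) ^ (γ - 1) * X (k+1) := by
      rw [← Real.rpow_add_one (hX0 _).ne']; ring_nf
    rw [h3] at h2
    rw [div_lt_iff₀ hε] at hk
    have h4 : 0 < X (k+1) ^ (γ - 1) := Real.rpow_pos_of_pos (hX0 _) _
    by_contra hcon
    push Not at hcon
    nlinarith [mul_le_mul_of_nonneg_left hcon h4.le]
  -- consecutive points are independent
  have hind : ∀ᶠ k in atTop, a k * b (k+1) - b k * a (k+1) ≠ 0 := by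
    filter_upwards [hsmall (1/2) (by norm_num)] with k hk hD
    have key : ∀ u v : ℤ, |(v : ℝ)| = X (k+1) → |(u : ℝ)| ≤ X k →
        v * a k = u * a (k+1) → v * b k = u * b (k+1) → False := by
      intro u v hv hu h1 h2
      have h1' : (v : ℝ) * a k = u * a (k+1) := by exact_mod_cast h1
      have h2' : (v : ℝ) * b k = u * b (k+1) := by exact_mod_cast h2
      obtain ⟨j, hj⟩ := hEa k
      have hj' := hE (k+1) j
      set e := θ j * a k + φ j * b k - y k j with he
      set e' := θ j * a (k+1) + φ j * b (k+1) - y (k+1) j with he'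
      have hid : (v : ℝ) * e - u * e' = ((u * y (k+1) j - v * y k j : ℤ) : ℝ) := by
        push_cast
        rw [he, he']
        linear_combination θ j * h1' + φ j * h2'
      have hue : |(u : ℝ) * e'| ≤ X (k+1) * Z (k+1) := by
        rw [abs_mul]
        exact mul_le_mul (hu.trans (hXm k)) hj' (abs_nonneg _) (hX0 _).le
      have hve : |(v : ℝ) * e| = X (k+1) * Z k := by rw [abs_mul, hv, hj]
      have hlt : X (k+1) * Z (k+1) < X (k+1) * Z k := mul_lt_mul_of_pos_left (hZd k) (hX0 _)
      by_cases h0 : u * y (k+1) j - v * y k j = 0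
      · rw [h0, Int.cast_zero, sub_eq_zero] at hid
        rw [hid] at hve
        linarith
      · have h5 : (1 : ℝ) ≤ |((u * y (k+1) j - v * y k j : ℤ) : ℝ)| := by
          exact_mod_cast Int.one_le_abs h0
        rw [← hid] at h5
        have := abs_sub ((v : ℝ) * e) (u * e')
        linarith
    rcases hab (k+1) with h | h
    · exact key (a k) (a (k+1)) h (ha k) (by ring) (by linarith)
    · exact key (b k) (b (k+1)) h (hb k) (by linarith) (by ring)
  -- the integer determinants
  let det : ℕ → Fin n → ℤ := fun k j =>
    y k j * (a (k+1) * b (k+2) - b (k+1) * a (k+2))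
    - y (k+1) j * (a k * b (k+2) - b k * a (k+2))
    + y (k+2) j * (a k * b (k+1) - b k * a (k+1))
  have hfreq : ∃ᶠ k in atTop, ∃ j, det k j ≠ 0 := by
    by_contra hcon
    rw [not_frequently] at hcon
    obtain ⟨N, hN⟩ := eventually_atTop.1 (hcon.and hind)
    have hdet : ∀ k, N ≤ k → ∀ j, det k j = 0 := fun k hk j => by
      have := (hN k hk).1
      push Not at this
      exact this j
    have hD : ∀ k, N ≤ k → (a k * b (k+1) - b k * a (k+1) : ℝ) ≠ 0 := fun k hk => by
      exact_mod_cast (hN k hk).2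
    obtain ⟨j, hj⟩ := hEa N
    set D : ℝ := a N * b (N+1) - b N * a (N+1) with hDdef
    have hD0 : D ≠ 0 := hD N le_rfl
    obtain ⟨r, hr⟩ : ∃ r : ℝ, r = (y N j * b (N+1) - b N * y (N+1) j) / D := ⟨_, rfl⟩
    obtain ⟨s, hs⟩ : ∃ s : ℝ, s = (a N * y (N+1) j - y N j * a (N+1)) / D := ⟨_, rfl⟩
    rw [eq_div_iff hD0] at hr hs
    have hall : ∀ i, (y (N+i) j = r * a (N+i) + s * b (N+i)) ∧
        (y (N+i+1) j = r * a (N+i+1) + s * b (N+i+1)) := by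
      intro i
      induction i with
      | zero =>
        constructor
        · apply mul_right_cancel₀ hD0
          simp only [Nat.add_zero]
          rw [hDdef] at hr hs ⊢
          linear_combination -(a N : ℝ) * hr - (b N : ℝ) * hs
        · apply mul_right_cancel₀ hD0
          simp only [Nat.add_zero]
          rw [hDdef] at hr hs ⊢
          linear_combination -(a (N+1) : ℝ) * hr - (b (N+1) : ℝ) * hs
      | succ i ih =>
        obtain ⟨h1, h2⟩ := ih
        refine ⟨h2, ?_⟩
        have h3 : ((det (N+i) j : ℤ) : ℝ) = 0 := by rw [hdet _ (by omega)]; simp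
        simp only [det] at h3
        push_cast at h3
        apply mul_right_cancel₀ (hD (N+i) (by omega))
        change (y (N+i+2) j : ℝ) * _ = (r * a (N+i+2) + s * b (N+i+2)) * _
        rw [h1, h2] at h3
        linear_combination h3
    have herr : ∀ k, N ≤ k → |(θ j - r) * a k + (φ j - s) * b k| ≤ Z k := by
      intro k hk
      obtain ⟨i, rfl⟩ := Nat.exists_eq_add_of_le hk
      have := hE (N+i) j
      rw [(hall i).1] at this
      convert this using 2
      ring
    have hbound : ∀ c : ℝ, (∀ k, N ≤ k → |c * (a k * b (k+1) - b k * a (k+1))| ≤ 2 * (X (k+1) * Z k)) →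
        c = 0 := by
      intro c hc
      by_contra hc0
      have hcp : 0 < |c| := abs_pos.2 hc0
      obtain ⟨k, hk, hkN⟩ := ((hsmall (|c| / 2) (by positivity)).and (eventually_ge_atTop N)).exists
      have h1 := hc k hkN
      rw [abs_mul] at h1
      have h2 : (1 : ℝ) ≤ |(a k * b (k+1) - b k * a (k+1) : ℝ)| := by
        exact_mod_cast Int.one_le_abs (hN k hkN).2
      nlinarith
    have hprod : ∀ k, N ≤ k → ∀ u v : ℤ, |(u : ℝ)| ≤ X (k+1) → |(v : ℝ)| ≤ X k →
        |((θ j - r) * a k + (φ j - s) * b k) * u - ((θ j - r) * a (k+1) + (φ j - s) * b (k+1)) * v|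
          ≤ 2 * (X (k+1) * Z k) := by
      intro k hk u v hu hv
      refine (abs_sub _ _).trans ?_
      rw [abs_mul, abs_mul]
      have h1 := mul_le_mul (herr k hk) hu (abs_nonneg _) (hZ0 k).le
      have h2 := mul_le_mul ((herr (k+1) (by omega)).trans (hZd k).le) (hv.trans (hXm k))
        (abs_nonneg _) (hZ0 k).le
      linarith
    have hc1 : θ j - r = 0 := by
      apply hbound
      intro k hk
      convert hprod k hk (b (k+1)) (b k) (hb _) (hb _) using 2
      ring
    have hc2 : φ j - s = 0 := by
      apply hbound
      intro k hk
      rw [← abs_neg]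
      convert hprod k hk (a (k+1)) (a k) (ha _) (ha _) using 2
      ring
    have h0 := (hall 0).1
    simp only [Nat.add_zero] at h0
    rw [h0, show θ j * a N + φ j * b N - (r * a N + s * b N) = (θ j - r) * a N + (φ j - s) * b N by ring,
      hc1, hc2] at hj
    simp at hj
    exact (hZ0 N).ne hj
  refine ⟨(6 * C) ^ γ * C, ?_⟩
  rw [frequently_atTop]
  intro M
  obtain ⟨k, hk, j, hj⟩ := frequently_atTop.1 hfreq (max M K)
  refine ⟨k+1, by have := le_max_left M K; omega, ?_⟩
  have hkK : K ≤ k := (le_max_right M K).trans hk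
  have h1 : (1 : ℝ) ≤ |(det k j : ℝ)| := by exact_mod_cast Int.one_le_abs hj
  have hmin : ∀ p q : ℕ, ∀ P Q : ℝ, X p ≤ P → X q ≤ Q →
      |(a p * b q - b p * a q : ℝ)| ≤ 2 * (P * Q) := by
    intro p q P Q hP hQ
    refine (abs_sub _ _).trans ?_
    rw [abs_mul, abs_mul]
    have hP0 : 0 ≤ P := (hX0 p).le.trans hP
    have h1 := mul_le_mul ((ha p).trans hP) ((hb q).trans hQ) (abs_nonneg _) hP0
    have h2 := mul_le_mul ((hb p).trans hP) ((ha q).trans hQ) (abs_nonneg _) hP0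
    linarith
  have hXX : 0 < X (k+1) * X (k+2) := mul_pos (hX0 _) (hX0 _)
  have h6 : |(det k j : ℝ)| ≤ 6 * (X (k+1) * X (k+2)) * Z k := by
    have hid : (det k j : ℝ) =
      -((θ j * a k + φ j * b k - y k j) * (a (k+1) * b (k+2) - b (k+1) * a (k+2)))
      + (θ j * a (k+1) + φ j * b (k+1) - y (k+1) j) * (a k * b (k+2) - b k * a (k+2))
      - (θ j * a (k+2) + φ j * b (k+2) - y (k+2) j) * (a k * b (k+1) - b k * a (k+1)) := by
      simp only [det]
      push_cast
      ring
    rw [hid]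
    refine (abs_sub _ _).trans ?_
    refine (add_le_add_left (abs_add_le _ _) _).trans ?_
    rw [abs_neg, abs_mul, abs_mul, abs_mul]
    have e1 := mul_le_mul (hE k j) (hmin (k+1) (k+2) _ _ le_rfl le_rfl) (abs_nonneg _) (hZ0 k).le
    have e2 := mul_le_mul ((hE (k+1) j).trans (hZd k).le) (hmin k (k+2) _ _ (hXm k) le_rfl)
      (abs_nonneg _) (hZ0 k).le
    have e3 := mul_le_mul ((hE (k+2) j).trans ((hZd (k+1)).le.trans (hZd k).le))
      (hmin k (k+1) _ _ (hXm k) (hXm (k+1))) (abs_nonneg _) (hZ0 k).le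
    linarith
  have h7 : X (k+1) ^ (γ - 1) ≤ 6 * C * X (k+2) := by
    have h2 := hC k hkK
    have h3 : X (k+1) ^ γ = X (k+1) ^ (γ - 1) * X (k+1) := by
      rw [← Real.rpow_add_one (hX0 _).ne']; ring_nf
    have h4 : 0 < X (k+1) ^ (γ - 1) := Real.rpow_pos_of_pos (hX0 _) _
    rw [h3] at h2
    calc X (k+1) ^ (γ - 1) = X (k+1) ^ (γ - 1) * 1 := by ring
      _ ≤ X (k+1) ^ (γ - 1) * (6 * (X (k+1) * X (k+2)) * Z k) :=
        mul_le_mul_of_nonneg_left (h1.trans h6) h4.le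
      _ = 6 * X (k+2) * (X (k+1) ^ (γ - 1) * X (k+1) * Z k) := by ring
      _ ≤ 6 * X (k+2) * C := mul_le_mul_of_nonneg_left h2 (by have := hX0 (k+2); positivity)
      _ = 6 * C * X (k+2) := by ring
  have h8 : X (k+1) ^ (γ * (γ - 1)) ≤ (6 * C) ^ γ * X (k+2) ^ γ := by
    rw [mul_comm γ, Real.rpow_mul (hX0 _).le, ← Real.mul_rpow (by positivity) (hX0 _).le]
    exact Real.rpow_le_rpow (Real.rpow_nonneg (hX0 _).le _) h7 (by linarith)
  calc X (k+1) ^ (γ * (γ - 1)) * Z (k+1) ≤ (6 * C) ^ γ * X (k+2) ^ γ * Z (k+1) :=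
        mul_le_mul_of_nonneg_right h8 (hZ0 _).le
    _ = (6 * C) ^ γ * (X (k+2) ^ γ * Z (k+1)) := by ring
    _ ≤ (6 * C) ^ γ * C := mul_le_mul_of_nonneg_left (hC (k+1) (by omega)) (by positivity)

/-- The approximation quality of an integer vector. -/
noncomputable def errE {n : ℕ} (Θ : Matrix (Fin n) (Fin 2) ℝ) (x : Fin 2 → ℤ) : ℝ :=
  ⨆ j : Fin n, nid (∑ i, Θ j i * (x i : ℝ))

lemma psiFn_le {n : ℕ} (Θ : Matrix (Fin n) (Fin 2) ℝ) {x : Fin 2 → ℤ} (hx : x ≠ 0) {t : ℝ}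
    (ht : (heightM x : ℝ) ≤ t) : psiFn Θ t ≤ ENNReal.ofReal (errE Θ x) :=
  (iInf_le _ x).trans ((iInf_le _ hx).trans (iInf_le _ ht))

lemma le_psiFn {n : ℕ} (Θ : Matrix (Fin n) (Fin 2) ℝ) {t c : ℝ}
    (h : ∀ x : Fin 2 → ℤ, x ≠ 0 → (heightM x : ℝ) ≤ t → c ≤ errE Θ x) :
    ENNReal.ofReal c ≤ psiFn Θ t :=
  le_iInf fun x => le_iInf fun hx => le_iInf fun ht => ENNReal.ofReal_le_ofReal (h x hx ht)

lemma heightM_two (x : Fin 2 → ℤ) : heightM x = max (x 0).natAbs (x 1).natAbs := by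
  simp [heightM, Fin.univ_succ]

lemma heightM_pos {x : Fin 2 → ℤ} (hx : x ≠ 0) : 1 ≤ heightM x := by
  by_contra h
  apply hx
  rw [heightM_two] at h
  ext i
  fin_cases i <;> simp <;> omega

lemma jarnik_step {n : ℕ} (Θ : Matrix (Fin n) (Fin 2) ℝ)
    (hpos : ∀ t : ℝ, 0 < t → 0 < psiFn Θ t) {γ : ℝ} (hγ : 1 < γ) (hu : γ ∈ uniformExps Θ) :
    γ * (γ - 1) ∈ individualExps Θ := by
  obtain ⟨-, hlim⟩ := hu
  have hEpos : ∀ x : Fin 2 → ℤ, x ≠ 0 → 0 < errE Θ x := by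
    intro x hx
    have h1 := heightM_pos hx
    have := (hpos (heightM x) (by exact_mod_cast h1)).trans_le (psiFn_le Θ hx le_rfl)
    exact ENNReal.ofReal_pos.1 this
  obtain ⟨B, hB, hBt⟩ := exists_between hlim
  obtain ⟨T, hT⟩ := eventually_atTop.1 (eventually_lt_of_limsup_lt hB)
  -- the key upper bound
  have hup : ∀ c t : ℝ, 0 ≤ c → 0 < t → T ≤ t →
      (∀ x : Fin 2 → ℤ, x ≠ 0 → (heightM x : ℝ) ≤ t → c ≤ errE Θ x) → t ^ γ * c ≤ B.toReal := by
    intro c t hc ht hTt h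
    have h1 := le_psiFn Θ h
    have h2 := (mul_le_mul_right h1 (ENNReal.ofReal (t ^ γ))).trans (hT t hTt).le
    rw [← ENNReal.ofReal_mul (Real.rpow_nonneg ht.le _)] at h2
    exact (ENNReal.ofReal_le_iff_le_toReal hBt.ne).1 h2
  have hexists : ∀ c : ℝ, 0 < c → ∃ x : Fin 2 → ℤ, x ≠ 0 ∧ errE Θ x < c := by
    intro c hc
    by_contra hcon
    push Not at hcon
    have h1 : Tendsto (fun t : ℝ => t ^ γ * c) atTop atTop :=
      (tendsto_rpow_atTop (by linarith)).atTop_mul_const hc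
    obtain ⟨t, h2, h3, h4⟩ := ((h1.eventually_gt_atTop B.toReal).and
      ((eventually_gt_atTop 0).and (eventually_ge_atTop T))).exists
    exact absurd (hup c t hc.le h3 h4 (fun x hx _ => hcon x hx)) (not_le.2 h2)
  have hnext : ∀ c : ℝ, 0 < c → ∃ x : Fin 2 → ℤ, x ≠ 0 ∧ errE Θ x < c ∧
      ∀ z : Fin 2 → ℤ, z ≠ 0 → errE Θ z < c → heightM x ≤ heightM z := by
    intro c hc
    obtain ⟨x, ⟨h1, h2⟩, h3⟩ := (measure (heightM (m := 2))).wf.has_min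
      {x : Fin 2 → ℤ | x ≠ 0 ∧ errE Θ x < c} (hexists c hc)
    exact ⟨x, h1, h2, fun z hz hzc => not_lt.1 (h3 z ⟨hz, hzc⟩)⟩
  choose f hf0 hf1 hf2 using hnext
  let S := {x : Fin 2 → ℤ // x ≠ 0}
  let nxt : S → S := fun s => ⟨f (errE Θ s.1) (hEpos _ s.2), hf0 _ _⟩
  let s : ℕ → S := fun k => nxt^[k+1] ⟨fun _ => 1, fun h => one_ne_zero (congrFun h 0)⟩
  have hs : ∀ k, s (k+1) = nxt (s k) := fun k => Function.iterate_succ_apply' _ _ _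
  obtain ⟨x, hx⟩ : ∃ x : ℕ → Fin 2 → ℤ, x = fun k => (s k).1 := ⟨_, rfl⟩
  have hx0 : ∀ k, x k ≠ 0 := fun k => by rw [hx]; exact (s k).2
  have hxd : ∀ k, errE Θ (x (k+1)) < errE Θ (x k) := fun k => by
    rw [hx]; simp only [hs]; exact hf1 _ _
  have hxmin : ∀ k z, z ≠ 0 → errE Θ z < errE Θ (x k) → heightM (x (k+1)) ≤ heightM z :=
    fun k z => by
      rw [hx]; simp only [hs]; exact hf2 _ _ z
  clear_value s
  have hanti : StrictAnti (fun k => errE Θ (x k)) := strictAnti_nat_of_succ_lt hxd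
  have hinj : Function.Injective x := fun p q h => hanti.injective (congrArg (errE Θ) h)
  have hm1 : ∀ k, heightM (x (k+1)) ≤ heightM (x (k+2)) := fun k =>
    hxmin k _ (hx0 _) ((hxd _).trans (hxd _))
  have htend : Tendsto (fun k => heightM (x k)) atTop atTop := by
    rw [← Nat.cofinite_eq_atTop]
    refine Tendsto.comp (g := heightM (m := 2)) (y := cofinite) ?_ hinj.tendsto_cofinite
    rw [Nat.cofinite_eq_atTop, tendsto_atTop]
    intro b
    have hfi : (Set.Icc (fun _ => -(b : ℤ)) (fun _ => (b : ℤ)) : Set (Fin 2 → ℤ)).Finite :=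
      Set.finite_Icc _ _
    refine (hfi.subset ?_)
    intro z hz
    simp only [Set.mem_compl_iff, Set.mem_setOf_eq, not_le, heightM_two] at hz
    rw [Set.mem_Icc, Pi.le_def, Pi.le_def]
    constructor <;> intro i <;> fin_cases i <;> simp <;> omega
  have htend' : Tendsto (fun k => (heightM (x (k+1)) : ℝ)) atTop atTop :=
    tendsto_natCast_atTop_atTop.comp (htend.comp (tendsto_add_atTop_nat 1))
  obtain ⟨K, hK⟩ := eventually_atTop.1 (htend'.eventually_ge_atTop (2 * T))
  have hn : Nonempty (Fin n) := by
    by_contra h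
    rw [not_nonempty_iff] at h
    have := hEpos _ (hx0 0)
    simp [errE] at this
  have hsum : ∀ k (j : Fin n), ∑ i, Θ j i * (x k i : ℝ) = Θ j 0 * x k 0 + Θ j 1 * x k 1 :=
    fun k j => by simp [Fin.sum_univ_two]
  obtain ⟨C', hC'⟩ := jarnik_core (fun j => Θ j 0) (fun j => Θ j 1)
    (fun k => x (k+1) 0) (fun k => x (k+1) 1)
    (fun k j => round (Θ j 0 * x (k+1) 0 + Θ j 1 * x (k+1) 1))
    (fun k => (heightM (x (k+1)) : ℝ)) (fun k => errE Θ (x (k+1))) γ (2 ^ γ * B.toReal) K hγ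
    (fun k => by
      rw [heightM_two, ← Int.cast_abs, Int.abs_eq_natAbs, Int.cast_natCast]
      exact Nat.cast_le.2 (le_max_left _ _))
    (fun k => by
      rw [heightM_two, ← Int.cast_abs, Int.abs_eq_natAbs, Int.cast_natCast]
      exact Nat.cast_le.2 (le_max_right _ _))
    (fun k => by
      rw [heightM_two, ← Int.cast_abs, Int.abs_eq_natAbs, ← Int.cast_abs, Int.abs_eq_natAbs]
      rcases max_choice (x (k+1) 0).natAbs (x (k+1) 1).natAbs with h | h
      · left; rw [h]; simp
      · right; rw [h]; simp)
    (fun k => by exact_mod_cast heightM_pos (hx0 _))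
    (fun k => by exact_mod_cast hm1 k) htend' (fun k => hEpos _ (hx0 _)) (fun k => hxd _)
    (fun k j => by
      have := le_ciSup (f := fun j : Fin n => nid (∑ i, Θ j i * (x (k+1) i : ℝ)))
        (Set.finite_range _).bddAbove j
      simp only [hsum] at this
      simpa only [errE, nid, hsum] using this)
    (fun k => by
      obtain ⟨j, hj⟩ := exists_eq_ciSup_of_finite
        (f := fun j : Fin n => nid (∑ i, Θ j i * (x (k+1) i : ℝ)))
      refine ⟨j, ?_⟩
      simpa only [errE, nid, hsum] using hj)
    (fun k hk => by
      have hh : (1 : ℝ) ≤ heightM (x (k+1+1)) := by exact_mod_cast heightM_pos (hx0 _)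
      have hKk := hK (k+1) (by omega)
      have := hup (errE Θ (x (k+1))) ((heightM (x (k+1+1)) : ℝ) / 2) (hEpos _ (hx0 _)).le
        (by linarith) (by linarith) (fun z hz hzt => by
          by_contra hcon
          push Not at hcon
          have h1 : (heightM (x (k+1+1)) : ℝ) ≤ heightM z := by
            exact_mod_cast hxmin _ z hz hcon
          linarith)
      rw [Real.div_rpow (by linarith) (by norm_num), div_mul_eq_mul_div,
        div_le_iff₀ (by positivity)] at this
      linarith)
  refine ⟨mul_pos (by linarith) (by linarith), ?_⟩
  refine lt_of_le_of_lt (liminf_le_of_frequently_le' (x := ENNReal.ofReal C') ?_) ENNReal.ofReal_lt_top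
  refine htend'.frequently (hC'.mono fun k hk => ?_)
  refine (mul_le_mul_right (psiFn_le Θ (hx0 (k+1)) le_rfl) _).trans ?_
  rw [← ENNReal.ofReal_mul (by positivity)]
  exact ENNReal.ofReal_le_ofReal hk

/-- **Jarník's theorem, case (ii) (`m = 2`).** For an `n × 2` real matrix `Θ` with
`ψ_Θ(t) > 0` for all `t > 0` and `α(Θ)` finite, one has `β(Θ) ≥ α(Θ)(α(Θ) − 1)`. -/
theorem jarnik_m2 {n : ℕ} (Θ : Matrix (Fin n) (Fin 2) ℝ)
    (hpos : ∀ t : ℝ, 0 < t → 0 < psiFn Θ t)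
    (hfin : alphaExp Θ ≠ ⊤) :
    ENNReal.ofReal ((alphaExp Θ).toReal * ((alphaExp Θ).toReal - 1)) ≤ betaExp Θ := by
  rcases le_or_gt (alphaExp Θ).toReal 1 with h1 | h1
  · rw [ENNReal.ofReal_of_nonpos]
    · exact zero_le
    · exact mul_nonpos_of_nonneg_of_nonpos ENNReal.toReal_nonneg (by linarith)
  by_cases hb : betaExp Θ = ⊤
  · rw [hb]; exact le_top
  set b := (betaExp Θ).toReal with hbdef
  have hb0 : 0 ≤ b := ENNReal.toReal_nonneg
  set q := √(1 + 4 * b) with hq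
  have hq2 : q * q = 1 + 4 * b := Real.mul_self_sqrt (by linarith)
  have hq1 : 1 ≤ q := Real.one_le_sqrt.2 (by linarith)
  have hle : alphaExp Θ ≤ ENNReal.ofReal ((1 + q) / 2) := by
    refine sSup_le ?_
    rintro _ ⟨γ, hγ, rfl⟩
    apply ENNReal.ofReal_le_ofReal
    rcases le_or_gt γ 1 with h | h
    · linarith
    · have h2 : ENNReal.ofReal (γ * (γ - 1)) ≤ betaExp Θ :=
        le_sSup ⟨_, jarnik_step Θ hpos h hγ, rfl⟩
      rw [ENNReal.ofReal_le_iff_le_toReal hb, ← hbdef] at h2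
      by_contra hcon
      push Not at hcon
      nlinarith
  have hle2 := ENNReal.toReal_le_of_le_ofReal (by linarith) hle
  rw [ENNReal.ofReal_le_iff_le_toReal hb, ← hbdef]
  nlinarith
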